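/- Let f be a minmax monotone cost function on a finite tree T_in, 𝒯 ≥ 0, and T = (V,E) a rooted working subtree with sink set S and hub tree T_{H(S)}. Let v ∈ V_{H(S)} be such that T(v) is RC-viable, let u_1,…,u_j be the children of v in T_{H(S)}, and assume each T_{-v}(u_i) is recursively self-sufficient. Then exactly one of the following holds: (i) there exists i such that f(BP(v,s), s) > 𝒯 for every sink s ∈ S ∩ V_{-v}(u_i), and in this case the ordered pair (u_i, v) satisfies the reaching criterion; or (ii) for every i there exists a sink s ∈ S ∩ V_{-v}(u_i) with f(BP(v,s), s) ≤ 𝒯, and in this case T(v) is recursively self-sufficient. -/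

import Mathlib

open SimpleGraph Set
open scoped ENNReal

variable {V : Type*}

/-- The vertex set of the connected component of the subgraph of `G` induced on `A`
containing the vertex `u` (empty if `u ∉ A`). -/
def reachSet (G : SimpleGraph V) (A : Set V) (u : V) : Set V :=
  {y | ∃ (hu : u ∈ A) (hy : y ∈ A), (G.induce A).Reachable ⟨u, hu⟩ ⟨y, hy⟩}

/-- `U` is a subtree: the induced subgraph on `U` is connected. -/
def IsSubtree (G : SimpleGraph V) (U : Set V) : Prop :=
  (G.induce U).Connected

/-- A minmax monotone cost function on the tree `G`:
`f {s} s = 0`; `f U s = ∞` if `U` is not a subtree or `s ∉ U`; set monotonicity;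
path monotonicity; and max tree composition (the slices of `U` defined by `s` being the
connected components of `U \ {s}`). -/
structure IsMinmaxMonotone (G : SimpleGraph V) (f : Set V → V → ℝ≥0∞) : Prop where
  singleton_eq_zero : ∀ s : V, f {s} s = 0
  eq_top_of_not_subtree : ∀ (U : Set V) (s : V), ¬ IsSubtree G U → f U s = ⊤
  eq_top_of_not_mem : ∀ (U : Set V) (s : V), s ∉ U → f U s = ⊤
  set_mono : ∀ (U₁ U₂ : Set V) (s : V), IsSubtree G U₁ → IsSubtree G U₂ →
    s ∈ U₁ → U₁ ⊆ U₂ → f U₁ s ≤ f U₂ s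
  path_mono : ∀ (U : Set V) (s u : V), IsSubtree G U → s ∉ U → u ∈ U → G.Adj s u →
    f U u ≤ f (U ∪ {s}) s
  max_comp : ∀ (U : Set V) (s : V), IsSubtree G U → s ∈ U →
    f U s = ⨆ x ∈ U \ {s}, f (reachSet G (U \ {s}) x ∪ {s}) s

/-- `s` is a leaf of the (working) tree induced on `W`. -/
def IsLeafOf (G : SimpleGraph V) (W : Set V) (s : V) : Prop :=
  s ∈ W ∧ ∃! u, u ∈ W ∧ G.Adj s u

/-- The ordered pair `(u,v)` satisfies the peaking criterion in the working tree on `W`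
with sink set `S` and threshold `𝒯`. -/
def PeakingPair (G : SimpleGraph V) (f : Set V → V → ℝ≥0∞) (𝒯 : ℝ≥0∞)
    (W S : Set V) (u v : V) : Prop :=
  u ∈ W ∧ v ∈ W ∧ G.Adj u v ∧ S ∩ reachSet G (W \ {v}) u = ∅ ∧
    f (reachSet G (W \ {v}) u) u ≤ 𝒯 ∧ 𝒯 < f (reachSet G (W \ {v}) u ∪ {v}) v

/-- `w` lies on the unique path from `a` to `b` in the tree induced on `W`. -/
def OnPath (G : SimpleGraph V) (W : Set V) (a b w : V) : Prop :=
  a ∈ W ∧ b ∈ W ∧ w ∈ W ∧ b ∉ reachSet G (W \ {w}) a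

/-- Vertices of the hub tree: union of the paths from the sinks to the root `r`. -/
def hubVerts (G : SimpleGraph V) (W S : Set V) (r : V) : Set V :=
  {w | ∃ s ∈ S, OnPath G W s r w}

/-- `r` is a valid root: a non-sink vertex of the working tree such that at least two of
the subtrees hanging off it contain sinks. -/
def GoodRoot (G : SimpleGraph V) (W S : Set V) (r : V) : Prop :=
  r ∈ W ∧ r ∉ S ∧
    ∃ η₁ η₂ : V, η₁ ≠ η₂ ∧ η₁ ∈ W ∧ η₂ ∈ W ∧ G.Adj r η₁ ∧ G.Adj r η₂ ∧
      (S ∩ reachSet G (W \ {r}) η₁).Nonempty ∧ (S ∩ reachSet G (W \ {r}) η₂).Nonempty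

/-- The working tree on `W` is RC-viable w.r.t. sinks `S` and root `r`: every outstanding
branch, together with the hub-tree node it is attached to, has cost at most `𝒯`. -/
def RCViable (G : SimpleGraph V) (f : Set V → V → ℝ≥0∞) (𝒯 : ℝ≥0∞)
    (W S : Set V) (r : V) : Prop :=
  ∀ w ∈ hubVerts G W S r, ∀ η ∈ W, G.Adj w η → η ∉ hubVerts G W S r →
    f (reachSet G (W \ {w}) η ∪ {w}) w ≤ 𝒯

/-- The set `A` is self-sufficient: it can be partitioned into subtree blocks, one for
each sink in `S ∩ A`, each block containing its sink and having cost at most `𝒯`. -/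
def SelfSufficient (G : SimpleGraph V) (f : Set V → V → ℝ≥0∞) (𝒯 : ℝ≥0∞)
    (S A : Set V) : Prop :=
  ∃ P : V → Set V,
    (⋃ s ∈ S ∩ A, P s) = A ∧
    (∀ s ∈ S ∩ A, IsSubtree G (P s) ∧ s ∈ P s ∧ f (P s) s ≤ 𝒯) ∧
    (S ∩ A).Pairwise fun s t => Disjoint (P s) (P t)

/-- The vertices of the path `Π(a,b)` in the tree induced on `W`. -/
def pathSet (G : SimpleGraph V) (W : Set V) (a b : V) : Set V :=
  {w | OnPath G W a b w}

/-- All vertices of outstanding branches attached to `w` (given hub-tree vertices `Hub`). -/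
def branchesAt (G : SimpleGraph V) (W Hub : Set V) (w : V) : Set V :=
  ⋃ η ∈ {η : V | η ∈ W ∧ G.Adj w η ∧ η ∉ Hub}, reachSet G (W \ {w}) η

/-- The bulk path `BP(a,b)`: the path `Π(a,b)` together with all outstanding branches
attached to its vertices. -/
def bulkPath (G : SimpleGraph V) (W S : Set V) (r a b : V) : Set V :=
  pathSet G W a b ∪ ⋃ w ∈ pathSet G W a b, branchesAt G W (hubVerts G W S r) w

/-- `v` is the parent of `u` in the hub tree rooted at `r`. -/
def HubParent (G : SimpleGraph V) (W S : Set V) (r u v : V) : Prop :=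
  u ∈ hubVerts G W S r ∧ v ∈ hubVerts G W S r ∧ G.Adj u v ∧ OnPath G W u r v

/-- The ordered pair `(u,v)` satisfies the reaching criterion: `v` is the hub-tree parent
of `u`, `T₋ᵥ(u)` is self-sufficient, and `BP(v,v) ∪ V₋ᵥ(u)` is not self-sufficient. -/
def ReachingPair (G : SimpleGraph V) (f : Set V → V → ℝ≥0∞) (𝒯 : ℝ≥0∞)
    (W S : Set V) (r u v : V) : Prop :=
  HubParent G W S r u v ∧
  SelfSufficient G f 𝒯 S (reachSet G (W \ {v}) u) ∧
  ¬ SelfSufficient G f 𝒯 S (bulkPath G W S r v v ∪ reachSet G (W \ {v}) u)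

/-- The vertex set `V(v)` of the subtree of the working tree (rooted at `r`) rooted at `v`:
all vertices whose path to the root passes through `v`. -/
def rootedBelow (G : SimpleGraph V) (W : Set V) (r v : V) : Set V :=
  {x | OnPath G W x r v}

/-- The rooted subtree `T(v)` is RC-viable: every outstanding branch attached to a
hub-tree node lying in `T(v)` has, together with its attachment node, cost at most `𝒯`. -/
def RCViableBelow (G : SimpleGraph V) (f : Set V → V → ℝ≥0∞) (𝒯 : ℝ≥0∞)
    (W S : Set V) (r v : V) : Prop :=
  ∀ w ∈ hubVerts G W S r ∩ rootedBelow G W r v, ∀ η ∈ W, G.Adj w η →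
    η ∉ hubVerts G W S r → f (reachSet G (W \ {w}) η ∪ {w}) w ≤ 𝒯

/-- The subtree with vertex set `A` (of the working tree rooted at `r`) is recursively
self-sufficient: for every hub-tree node `w` in `A`, the part of `A` lying below `w`
is self-sufficient. -/
def RecursivelySelfSufficientOn (G : SimpleGraph V) (f : Set V → V → ℝ≥0∞) (𝒯 : ℝ≥0∞)
    (W S : Set V) (r : V) (A : Set V) : Prop :=
  ∀ w ∈ hubVerts G W S r ∩ A, SelfSufficient G f 𝒯 S (rootedBelow G W r w ∩ A)

/-- A feasible sink configuration: a partition of all of `V_in` into subtree blocks,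
one per sink, each block containing exactly its own sink and having cost at most `𝒯`. -/
def IsFeasibleConfig (G : SimpleGraph V) (f : Set V → V → ℝ≥0∞) (𝒯 : ℝ≥0∞)
    (St : Set V) (P : V → Set V) : Prop :=
  (⋃ s ∈ St, P s) = Set.univ ∧
  St.Pairwise (fun s t => Disjoint (P s) (P t)) ∧
  ∀ s ∈ St, IsSubtree G (P s) ∧ St ∩ P s = {s} ∧ f (P s) s ≤ 𝒯

/-- An optimal feasible sink configuration: one with the minimum number of sinks. -/
def IsOptimalConfig (G : SimpleGraph V) (f : Set V → V → ℝ≥0∞) (𝒯 : ℝ≥0∞)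
    (St : Set V) (P : V → Set V) : Prop :=
  IsFeasibleConfig G f 𝒯 St P ∧
  ∀ (St' : Set V) (P' : V → Set V), IsFeasibleConfig G f 𝒯 St' P' → St.ncard ≤ St'.ncard

/-- A partial sink configuration relative to the working tree on `W`: pairwise disjoint
subtree blocks of cost at most `𝒯`, one per sink of `Sout`, covering `V_in \ (W \ Sout)`. -/
def IsPartialConfig (G : SimpleGraph V) (f : Set V → V → ℝ≥0∞) (𝒯 : ℝ≥0∞)
    (W : Set V) (Sout : Set V) (P : V → Set V) : Prop :=
  Sout.Pairwise (fun s t => Disjoint (P s) (P t)) ∧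
  (∀ s ∈ Sout, IsSubtree G (P s) ∧ s ∈ P s ∧ f (P s) s ≤ 𝒯) ∧
  (⋃ s ∈ Sout, P s) = Set.univ \ (W \ Sout)

/-- `(St, Pt)` is an optimal feasible sink configuration witnessing the optimality of the
partial configuration `(Sout, P)` relative to the working tree on `W` (conditions (C1)-(C3)). -/
def WitnessesOptimality (G : SimpleGraph V) (f : Set V → V → ℝ≥0∞) (𝒯 : ℝ≥0∞)
    (W : Set V) (Sout : Set V) (P : V → Set V) (St : Set V) (Pt : V → Set V) : Prop :=
  IsOptimalConfig G f 𝒯 St Pt ∧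
  Sout ⊆ St ∧
  St \ W = Sout \ W ∧
  (∀ s ∈ Sout ∩ W, IsLeafOf G W s) ∧
  (∀ s ∈ St, s ∉ W → Pt s = P s ∧ Pt s ∩ W = ∅) ∧
  (∀ s ∈ Sout ∩ W, P s ⊆ Pt s ∧ Pt s \ P s ⊆ W) ∧
  (∀ s ∈ St, s ∉ Sout → Pt s ⊆ W)

/-- The partial sink configuration `(Sout, P)` is optimal relative to the working tree on `W`. -/
def OptimalRelative (G : SimpleGraph V) (f : Set V → V → ℝ≥0∞) (𝒯 : ℝ≥0∞)
    (W : Set V) (Sout : Set V) (P : V → Set V) : Prop :=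
  ∃ (St : Set V) (Pt : V → Set V), WitnessesOptimality G f 𝒯 W Sout P St Pt

section ReachSet

variable {G : SimpleGraph V} {A B : Set V} {a b c x y z : V}

theorem reachSet_left_mem (h : y ∈ reachSet G A x) : x ∈ A := h.1

theorem reachSet_subset (h : y ∈ reachSet G A x) : y ∈ A := h.2.1

theorem mem_reachSet_self (h : x ∈ A) : x ∈ reachSet G A x := ⟨h, h, .rfl⟩

theorem mem_reachSet_symm (h : y ∈ reachSet G A x) : x ∈ reachSet G A y :=
  ⟨h.2.1, h.1, h.2.2.symm⟩

theorem mem_reachSet_trans (h : y ∈ reachSet G A x) (h' : z ∈ reachSet G A y) :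
    z ∈ reachSet G A x :=
  ⟨h.1, h'.2.1, h.2.2.trans h'.2.2⟩

theorem mem_reachSet_of_adj (hx : x ∈ A) (hy : y ∈ A) (h : G.Adj x y) :
    y ∈ reachSet G A x :=
  ⟨hx, hy, Adj.reachable (G := G.induce A) (u := ⟨x, hx⟩) (v := ⟨y, hy⟩) h⟩

theorem reachSet_induction {P : V → Prop} (h : y ∈ reachSet G A x) (base : P x)
    (step : ∀ a b, a ∈ reachSet G A x → b ∈ A → G.Adj a b → P a → P b) : P y := by
  obtain ⟨hx, hy, hr⟩ := h
  rw [reachable_iff_reflTransGen] at hr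
  suffices ∀ q : A, Relation.ReflTransGen (G.induce A).Adj ⟨x, hx⟩ q → P q from this _ hr
  intro q hq
  induction hq with
  | refl => exact base
  | tail h1 h2 ih =>
    exact step _ _ ⟨hx, Subtype.coe_prop _, (reachable_iff_reflTransGen _ _).2 h1⟩
      (Subtype.coe_prop _) h2 ih

theorem IsSubtree.mem_reachSet (h : IsSubtree G A) (hx : x ∈ A) (hy : y ∈ A) :
    y ∈ reachSet G A x :=
  ⟨hx, hy, h.preconnected _ _⟩

theorem isSubtree_of_forall_mem_reachSet (ht : z ∈ A)
    (h : ∀ x ∈ A, z ∈ reachSet G A x) : IsSubtree G A := by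
  have : Nonempty A := ⟨⟨z, ht⟩⟩
  exact ⟨fun p q => (h p p.2).2.2.trans (h q q.2).2.2.symm⟩

theorem mem_reachSet_diff_or (h : y ∈ reachSet G A x) (z : V) :
    y ∈ reachSet G (A \ {z}) x ∨ z ∈ reachSet G A x := by
  refine reachSet_induction
    (P := fun y => y ∈ reachSet G (A \ {z}) x ∨ z ∈ reachSet G A x) h ?_ ?_
  · by_cases hz : x = z
    · exact .inr (hz ▸ mem_reachSet_self (reachSet_left_mem h))
    · exact .inl (mem_reachSet_self ⟨reachSet_left_mem h, hz⟩)
  · rintro a b ha hb hab (h1 | h1)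
    · by_cases hz : b = z
      · exact .inr (hz ▸ mem_reachSet_trans ha
          (mem_reachSet_of_adj (reachSet_subset ha) hb hab))
      · exact .inl (mem_reachSet_trans h1
          (mem_reachSet_of_adj (reachSet_subset h1) ⟨hb, hz⟩ hab))
    · exact .inr h1

/-- Of two vertices, one can be reached without meeting the other. -/
theorem mem_reachSet_diff_or_mem_reachSet_diff (hab : a ≠ b) (h : a ∈ reachSet G A x) :
    a ∈ reachSet G (A \ {b}) x ∨ b ∈ reachSet G (A \ {a}) x := by
  rcases mem_reachSet_diff_or h b with h1 | h1
  · exact .inl h1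
  by_contra! hcon
  obtain ⟨hna, hnb⟩ := hcon
  have key : ∀ y, y ∈ reachSet G A x →
      y ∈ reachSet G (A \ {a}) x ∧ y ∈ reachSet G (A \ {b}) x := by
    intro y hy
    refine reachSet_induction
      (P := fun y => y ∈ reachSet G (A \ {a}) x ∧ y ∈ reachSet G (A \ {b}) x) hy ?_ ?_
    · have hx := reachSet_left_mem h
      have hxa : x ≠ a := by
        rintro rfl
        exact hna (mem_reachSet_self ⟨hx, hab⟩)
      have hxb : x ≠ b := by
        rintro rfl
        exact hnb (mem_reachSet_self ⟨hx, hab.symm⟩)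
      exact ⟨mem_reachSet_self ⟨hx, hxa⟩, mem_reachSet_self ⟨hx, hxb⟩⟩
    · rintro c d - hd hcd ⟨h2, h3⟩
      have hda : d ≠ a := by
        rintro rfl
        exact hna (mem_reachSet_trans h3
          (mem_reachSet_of_adj (reachSet_subset h3) ⟨hd, hab⟩ hcd))
      have hdb : d ≠ b := by
        rintro rfl
        exact hnb (mem_reachSet_trans h2
          (mem_reachSet_of_adj (reachSet_subset h2) ⟨hd, hab.symm⟩ hcd))
      exact ⟨mem_reachSet_trans h2 (mem_reachSet_of_adj (reachSet_subset h2) ⟨hd, hda⟩ hcd),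
        mem_reachSet_trans h3 (mem_reachSet_of_adj (reachSet_subset h3) ⟨hd, hdb⟩ hcd)⟩
  exact hna (key a h).2

theorem exists_adj_mem_reachSet_diff (hab : b ≠ a) (h : a ∈ reachSet G A b) :
    ∃ p, G.Adj a p ∧ p ∈ reachSet G (A \ {a}) b := by
  have key : a ∈ reachSet G (A \ {a}) b ∨ ∃ p, G.Adj a p ∧ p ∈ reachSet G (A \ {a}) b := by
    refine reachSet_induction
      (P := fun c => c ∈ reachSet G (A \ {a}) b ∨ ∃ p, G.Adj a p ∧ p ∈ reachSet G (A \ {a}) b)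
      h (.inl (mem_reachSet_self ⟨reachSet_left_mem h, hab⟩)) ?_
    rintro c d - hd hcd (h1 | h1)
    · by_cases hda : d = a
      · exact .inr ⟨c, hda ▸ hcd.symm, h1⟩
      · exact .inl (mem_reachSet_trans h1
          (mem_reachSet_of_adj (reachSet_subset h1) ⟨hd, hda⟩ hcd))
    · exact .inr h1
  rcases key with h1 | h1
  · exact absurd rfl (reachSet_subset h1).2
  · exact h1

theorem not_mem_reachSet_diff_of_adj (hG : G.IsAcyclic) (hxy : G.Adj x y)
    (h1 : z ∈ reachSet G (A \ {y}) x) (h2 : z ∈ reachSet G (B \ {x}) y) : False := by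
  have hb := isAcyclic_iff_forall_adj_isBridge.1 hG hxy
  rw [isBridge_iff] at hb
  have e1 : (G \ fromEdgeSet {s(x, y)}).Reachable x z := by
    refine reachSet_induction h1 .rfl ?_
    intro a b ha hb hab h
    refine h.trans (Adj.reachable ?_)
    have h3 := (reachSet_subset ha).2
    have h4 := hb.2
    simp only [mem_singleton_iff] at h3 h4
    simp only [sdiff_adj, fromEdgeSet_adj, mem_singleton_iff, Sym2.eq_iff, hab, true_and]
    tauto
  have e2 : (G \ fromEdgeSet {s(x, y)}).Reachable y z := by
    refine reachSet_induction h2 .rfl ?_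
    intro a b ha hb hab h
    refine h.trans (Adj.reachable ?_)
    have h3 := (reachSet_subset ha).2
    have h4 := hb.2
    simp only [mem_singleton_iff] at h3 h4
    simp only [sdiff_adj, fromEdgeSet_adj, mem_singleton_iff, Sym2.eq_iff, hab, true_and]
    tauto
  exact hb (e1.trans e2.symm)

end ReachSet

/-! The rooted order: `OnPath G W x r y` says that `y` is an ancestor of `x`. -/

section RootedOrder

variable {G : SimpleGraph V} {W : Set V} {r a b c p s u v w x y z : V}

theorem OnPath.left_mem (h : OnPath G W x r y) : x ∈ W := h.1

theorem OnPath.mem (h : OnPath G W x r y) : y ∈ W := h.2.2.1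

theorem onPath_self (hr : r ∈ W) (hx : x ∈ W) : OnPath G W x r x :=
  ⟨hx, hr, hx, fun h => (reachSet_left_mem h).2 rfl⟩

theorem onPath_root (hr : r ∈ W) (hx : x ∈ W) : OnPath G W x r r :=
  ⟨hx, hr, hr, fun h => (reachSet_subset h).2 rfl⟩

theorem OnPath.trans (h : OnPath G W x r y) (h' : OnPath G W y r z) : OnPath G W x r z := by
  refine ⟨h.1, h.2.1, h'.2.2.1, fun hr => ?_⟩
  rcases mem_reachSet_diff_or hr y with h1 | h1
  · refine h.2.2.2 (reachSet_induction h1 ?_ ?_)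
    · have := reachSet_left_mem h1
      exact mem_reachSet_self ⟨this.1.1, this.2⟩
    · intro a b _ hb hab ha
      exact mem_reachSet_trans ha
        (mem_reachSet_of_adj (reachSet_subset ha) ⟨hb.1.1, hb.2⟩ hab)
  · exact h'.2.2.2 (mem_reachSet_trans (mem_reachSet_symm h1) hr)

theorem OnPath.antisymm (hW : IsSubtree G W) (h : OnPath G W x r y) (h' : OnPath G W y r x) :
    x = y := by
  by_contra hne
  rcases mem_reachSet_diff_or_mem_reachSet_diff hne (hW.mem_reachSet h.2.1 h.1) with h1 | h1
  · exact h.2.2.2 (mem_reachSet_symm h1)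
  · exact h'.2.2.2 (mem_reachSet_symm h1)

theorem OnPath.total (hW : IsSubtree G W) (h : OnPath G W x r a) (h' : OnPath G W x r b) :
    OnPath G W a r b ∨ OnPath G W b r a := by
  by_cases hab : a = b
  · subst hab
    exact .inl (onPath_self h.2.1 h.mem)
  by_contra! hcon
  simp only [OnPath, h.mem, h'.mem, h.2.1, true_and, not_not] at hcon
  rcases mem_reachSet_diff_or_mem_reachSet_diff hab (hW.mem_reachSet h.1 h.mem) with h1 | h1
  · exact h'.2.2.2 (mem_reachSet_trans h1 hcon.1)
  · exact h.2.2.2 (mem_reachSet_trans h1 hcon.2)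

theorem onPath_or_onPath_of_adj (hG : G.IsAcyclic) (hr : r ∈ W) (hx : x ∈ W) (hy : y ∈ W)
    (hxy : G.Adj x y) : OnPath G W x r y ∨ OnPath G W y r x := by
  by_contra! hcon
  simp only [OnPath, hx, hy, hr, true_and, not_not] at hcon
  exact not_mem_reachSet_diff_of_adj hG hxy hcon.1 hcon.2

theorem OnPath.of_adj (h : OnPath G W x r y) (hne : x ≠ y) (hp : p ∈ W) (hxp : G.Adj x p) :
    OnPath G W p r y := by
  refine ⟨hp, h.2.1, h.mem, fun hr => h.2.2.2 ?_⟩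
  exact mem_reachSet_trans
    (mem_reachSet_of_adj ⟨h.1, hne⟩ (reachSet_left_mem hr) hxp) hr

theorem exists_parent (hG : G.IsAcyclic) (hW : IsSubtree G W) (hr : r ∈ W) (hx : x ∈ W)
    (hxr : x ≠ r) : ∃ p, G.Adj x p ∧ OnPath G W x r p := by
  obtain ⟨p, hxp, hp⟩ := exists_adj_mem_reachSet_diff hxr.symm (hW.mem_reachSet hr hx)
  refine ⟨p, hxp, ?_⟩
  rcases onPath_or_onPath_of_adj hG hr hx (reachSet_subset hp).1 hxp with h | h
  · exact h
  · exact absurd (mem_reachSet_symm hp) h.2.2.2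

/-- Induction along the ancestors of `s` up to `v`, starting from `v`. -/
theorem OnPath.climb [Finite V] (hG : G.IsAcyclic) (hW : IsSubtree G W) {P : V → Prop}
    (h : OnPath G W s r v) (base : P v)
    (step : ∀ x p, OnPath G W s r x → OnPath G W p r v → OnPath G W x r p → G.Adj x p →
      P p → P x) : P s := by
  suffices H : ∀ n x, {z | OnPath G W x r z}.ncard = n → OnPath G W s r x →
      OnPath G W x r v → P x from H _ s rfl (onPath_self h.2.1 h.1) h
  intro n
  induction n using Nat.strong_induction_on with
  | _ n ih =>
    intro x hn hsx hxv
    by_cases hne : x = v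
    · exact hne ▸ base
    have hxr : x ≠ r := by
      rintro rfl
      exact hne (hxv.antisymm hW (onPath_root hxv.1 hxv.mem))
    obtain ⟨p, hadj, hxp⟩ := exists_parent hG hW h.2.1 hxv.1 hxr
    have hpv := hxv.of_adj hne hxp.mem hadj
    refine step x p hsx hpv hxp hadj (ih _ ?_ p rfl (hsx.trans hxp) hpv)
    rw [← hn]
    refine Set.ncard_lt_ncard ⟨fun z hz => hxp.trans hz, fun hsub => ?_⟩ (Set.toFinite _)
    exact hadj.ne (hxp.antisymm hW (hsub (onPath_self h.2.1 hxv.1)))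

theorem OnPath.mem_reachSet [Finite V] (hG : G.IsAcyclic) (hW : IsSubtree G W) {A : Set V}
    (h : OnPath G W s r v) (hA : ∀ y, OnPath G W s r y → OnPath G W y r v → y ∈ A) :
    v ∈ reachSet G A s := by
  refine h.climb hG hW (P := fun x => v ∈ reachSet G A x) (mem_reachSet_self (hA v h (onPath_self h.2.1 h.mem))) ?_
  intro x p hsx hpv hxp hadj hp
  exact mem_reachSet_trans
    (mem_reachSet_of_adj (hA x hsx (hxp.trans hpv)) (reachSet_left_mem hp) hadj) hp

theorem OnPath.exists_child [Finite V] (hG : G.IsAcyclic) (hW : IsSubtree G W)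
    (h : OnPath G W x r y) (hne : x ≠ y) :
    ∃ c, G.Adj c y ∧ OnPath G W x r c ∧ OnPath G W c r y := by
  have key : x = y ∨ ∃ c, G.Adj c y ∧ OnPath G W x r c ∧ OnPath G W c r y := by
    refine h.climb hG hW (P := fun z => z = y ∨
      ∃ c, G.Adj c y ∧ OnPath G W z r c ∧ OnPath G W c r y) (.inl rfl) ?_
    rintro z p - hpy hzp hadj (rfl | ⟨c, h1, h2, h3⟩)
    · exact .inr ⟨z, hadj, onPath_self h.2.1 hzp.1, hzp⟩
    · exact .inr ⟨c, h1, hzp.trans h2, h3⟩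
  exact key.resolve_left hne

/-- A connected set that meets both sides of the edge above `w` contains `w` and its parent. -/
theorem exists_crossing {A : Set V} (hG : G.IsAcyclic) (hAW : A ⊆ W)
    (hA : z ∈ reachSet G A x) (hx : OnPath G W x r w) (hz : ¬ OnPath G W z r w) :
    w ∈ A ∧ ∃ p ∈ A, G.Adj w p ∧ OnPath G W w r p := by
  by_contra hcon
  refine hz (reachSet_induction (P := fun y => OnPath G W y r w) hA hx fun a b ha hb hab haw => ?_)
  by_cases hne : a = w
  · subst hne
    have haA := reachSet_subset ha
    rcases onPath_or_onPath_of_adj hG hx.2.1 haw.1 (hAW hb) hab with h | h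
    · exact absurd ⟨haA, b, hb, hab, h⟩ hcon
    · exact h
  · exact haw.of_adj hne (hAW hb) hab

theorem parent_unique (hW : IsSubtree G W) (h1 : G.Adj x a) (h2 : G.Adj x b)
    (ha : OnPath G W x r a) (hb : OnPath G W x r b) : a = b :=
  (hb.of_adj h2.ne ha.mem h1).antisymm hW (ha.of_adj h1.ne hb.mem h2)

theorem mem_of_onPath_of_mem_reachSet {A : Set V} (hG : G.IsAcyclic) (hW : IsSubtree G W)
    (hAW : A ⊆ W) (hA : v ∈ reachSet G A s) (h1 : OnPath G W s r w) (h2 : OnPath G W w r v) :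
    w ∈ A := by
  by_cases hne : v = w
  · exact hne ▸ reachSet_subset hA
  · exact (exists_crossing hG hAW hA h1 fun h => hne (h.antisymm hW h2)).1

theorem rootedBelow_inter_of_onPath (h : OnPath G W x r y) :
    rootedBelow G W r x ∩ rootedBelow G W r y = rootedBelow G W r x := by
  ext z
  exact ⟨And.left, fun hz => ⟨hz, OnPath.trans hz h⟩⟩

theorem reachSet_child [Finite V] (hG : G.IsAcyclic) (hW : IsSubtree G W)
    (hadj : G.Adj u v) (huv : OnPath G W u r v) :
    reachSet G (W \ {v}) u = rootedBelow G W r u := by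
  ext y
  refine ⟨fun hy => ?_, fun hy => ?_⟩
  · by_contra hcon
    obtain ⟨-, p, hp, h1, h2⟩ := exists_crossing hG sdiff_subset hy
      (onPath_self huv.2.1 huv.1) hcon
    exact hp.2 (parent_unique hW h1 hadj h2 huv)
  · refine mem_reachSet_symm (OnPath.mem_reachSet hG hW hy fun z _ hz => ⟨hz.1, ?_⟩)
    rintro rfl
    exact hadj.ne (huv.antisymm hW hz)

theorem mem_pathSet_iff [Finite V] (hG : G.IsAcyclic) (hW : IsSubtree G W)
    (h : OnPath G W s r v) :
    w ∈ pathSet G W v s ↔ OnPath G W s r w ∧ OnPath G W w r v := by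
  refine ⟨fun hw => ?_, fun hw => ?_⟩
  · by_contra hcon
    refine hw.2.2.2 (mem_reachSet_symm (h.mem_reachSet hG hW fun y h1 h2 => ⟨h2.1, ?_⟩))
    rintro rfl
    exact hcon ⟨h1, h2⟩
  · refine ⟨h.mem, h.1, hw.1.mem, fun hs => ?_⟩
    exact (mem_of_onPath_of_mem_reachSet hG hW sdiff_subset (mem_reachSet_symm hs)
      hw.1 hw.2).2 rfl

theorem mem_hubVerts_of_onPath {S : Set V} (hx : x ∈ hubVerts G W S r)
    (h : OnPath G W x r y) : y ∈ hubVerts G W S r := by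
  obtain ⟨s, hs, hsx⟩ := hx
  exact ⟨s, hs, hsx.trans h⟩

theorem mem_hubVerts_of_mem {S : Set V} (hr : r ∈ W) (hSW : S ⊆ W) (hx : x ∈ S) :
    x ∈ hubVerts G W S r :=
  ⟨x, hx, onPath_self hr (hSW hx)⟩

/-- The bulk path from `v` down to `s` consists of the vertices whose lowest ancestor in the
hub tree lies between `s` and `v`. -/
theorem mem_bulkPath_iff [Finite V] (hG : G.IsAcyclic) (hW : IsSubtree G W) {S : Set V}
    (hs : s ∈ hubVerts G W S r) (h : OnPath G W s r v) :
    x ∈ bulkPath G W S r v s ↔ ∃ w, OnPath G W s r w ∧ OnPath G W w r v ∧ OnPath G W x r w ∧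
      ∀ y ∈ hubVerts G W S r, OnPath G W x r y → OnPath G W y r w → y = w := by
  simp only [bulkPath, branchesAt, mem_union, mem_iUnion, mem_ofPred_eq, exists_prop,
    mem_pathSet_iff hG hW h]
  constructor
  · rintro (⟨h1, h2⟩ | ⟨w, ⟨h1, h2⟩, η, ⟨hηW, hadj, hη⟩, hx⟩)
    · exact ⟨x, h1, h2, onPath_self h.2.1 h2.1, fun y _ hxy hyx => hyx.antisymm hW hxy⟩
    · have hηw : OnPath G W η r w :=
        (onPath_or_onPath_of_adj hG h.2.1 h2.1 hηW hadj).resolve_left fun hc =>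
          hη (mem_hubVerts_of_onPath hs (h1.trans hc))
      rw [reachSet_child hG hW hadj.symm hηw] at hx
      refine ⟨w, h1, h2, OnPath.trans hx hηw, fun y hy hxy hyw => ?_⟩
      rcases OnPath.total hW hx hxy with hc | hc
      · by_cases hne : η = y
        · exact absurd (hne ▸ hy) hη
        · exact hyw.antisymm hW (hc.of_adj hne hηw.mem hadj.symm)
      · exact absurd (mem_hubVerts_of_onPath hy hc) hη
  · rintro ⟨w, h1, h2, hxw, hmin⟩
    by_cases hne : x = w
    · exact .inl (hne ▸ ⟨h1, h2⟩)
    obtain ⟨η, hadj, hxη, hηw⟩ := hxw.exists_child hG hW hne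
    refine .inr ⟨w, ⟨h1, h2⟩, η, ⟨hηw.1, hadj.symm, fun hc => ?_⟩, ?_⟩
    · exact hadj.ne (hmin η hc hxη hηw)
    · rw [reachSet_child hG hW hadj hηw]
      exact hxη

theorem isSubtree_bulkPath [Finite V] (hG : G.IsAcyclic) (hW : IsSubtree G W) {S : Set V}
    (hs : s ∈ hubVerts G W S r) (h : OnPath G W s r v) :
    IsSubtree G (bulkPath G W S r v s) := by
  refine isSubtree_of_forall_mem_reachSet (z := v) ?_ fun x hx => ?_
  · exact (mem_bulkPath_iff hG hW hs h).2 ⟨v, h, onPath_self h.2.1 h.mem,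
      onPath_self h.2.1 h.mem, fun y _ h1 h2 => h2.antisymm hW h1⟩
  · obtain ⟨w, h1, h2, h3, h4⟩ := (mem_bulkPath_iff hG hW hs h).1 hx
    refine (h3.trans h2).mem_reachSet hG hW fun y hxy hyv => ?_
    rw [mem_bulkPath_iff hG hW hs h]
    rcases h3.total hW hxy with hc | hc
    · exact ⟨y, h1.trans hc, hyv, onPath_self h.2.1 hyv.1,
        fun z _ hz1 hz2 => hz2.antisymm hW hz1⟩
    · exact ⟨w, h1, h2, hc, fun z hz hyz hzw => h4 z hz (hxy.trans hyz) hzw⟩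

theorem eq_of_onPath_of_isLeafOf [Finite V] (hG : G.IsAcyclic) (hW : IsSubtree G W)
    (hs : IsLeafOf G W s) (hsr : s ≠ r) (h : OnPath G W x r s) : x = s := by
  by_contra hne
  obtain ⟨c, hadj, -, hcs⟩ := h.exists_child hG hW hne
  obtain ⟨p, hsp, hp⟩ := exists_parent hG hW h.2.1 h.mem hsr
  have hcp : c = p := hs.2.unique ⟨hcs.1, hadj.symm⟩ ⟨hp.mem, hsp⟩
  subst hcp
  exact hadj.ne (hcs.antisymm hW hp)

end RootedOrder

section SelfSufficiency

variable {G : SimpleGraph V} {f : Set V → V → ℝ≥0∞} {𝒯 : ℝ≥0∞} {W S : Set V} {r s u v : V}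

theorem not_selfSufficient_of_forall_lt [Finite V] (hG : G.IsAcyclic)
    (hf : IsMinmaxMonotone G f) (hW : IsSubtree G W) (hSW : S ⊆ W)
    (hleaf : ∀ s ∈ S, IsLeafOf G W s) (hrS : r ∉ S) (hu : HubParent G W S r u v)
    (hlt : ∀ s ∈ S ∩ reachSet G (W \ {v}) u, 𝒯 < f (bulkPath G W S r v s) s) :
    ¬ SelfSufficient G f 𝒯 S (bulkPath G W S r v v ∪ reachSet G (W \ {v}) u) := by
  obtain ⟨huH, hvH, hadj, huv⟩ := hu
  have hr := huv.2.1
  have hvv : OnPath G W v r v := onPath_self hr huv.mem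
  rw [reachSet_child hG hW hadj huv] at hlt ⊢
  rintro ⟨P, hcov, hP, hdisj⟩
  set A := bulkPath G W S r v v ∪ rootedBelow G W r u
  have hvS : v ∉ S := fun hv =>
    hadj.ne (eq_of_onPath_of_isLeafOf hG hW (hleaf v hv) (ne_of_mem_of_not_mem hv hrS) huv)
  have hAW : A ⊆ W := by
    rintro x (hx | hx)
    · obtain ⟨w, -, -, h, -⟩ := (mem_bulkPath_iff hG hW hvH hvv).1 hx
      exact h.1
    · exact hx.1
  have hSA : ∀ t ∈ S ∩ A, OnPath G W t r u := by
    rintro t ⟨htS, ht | ht⟩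
    · obtain ⟨w, h1, h2, h3, h4⟩ := (mem_bulkPath_iff hG hW hvH hvv).1 ht
      obtain rfl := h2.antisymm hW h1
      have := h4 t (mem_hubVerts_of_mem hr hSW htS) (onPath_self hr h3.1) h3
      exact absurd (this ▸ htS) hvS
    · exact ht
  have hPA : ∀ t ∈ S ∩ A, P t ⊆ A := fun t ht x hx => by
    rw [← hcov]
    exact mem_biUnion ht hx
  have hvA : v ∈ A := .inl <| (mem_bulkPath_iff hG hW hvH hvv).2
    ⟨v, hvv, hvv, hvv, fun y _ h1 h2 => h2.antisymm hW h1⟩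
  obtain ⟨s, hs, hvP⟩ : ∃ s ∈ S ∩ A, v ∈ P s := by
    rw [← hcov] at hvA
    simpa only [mem_iUnion, exists_prop] using hvA
  have hsv : OnPath G W s r v := (hSA s hs).trans huv
  have hsH := mem_hubVerts_of_mem (G := G) hr hSW hs.1
  obtain ⟨hPs, hsP, hfs⟩ := hP s hs
  refine absurd ((hf.set_mono _ _ s (isSubtree_bulkPath hG hW hsH hsv) hPs ?_ ?_).trans hfs)
    (hlt s ⟨hs.1, hSA s hs⟩).not_ge
  · exact (mem_bulkPath_iff hG hW hsH hsv).2 ⟨s, onPath_self hr hsv.1, hsv,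
      onPath_self hr hsv.1, fun y _ h1 h2 => h2.antisymm hW h1⟩
  · intro x hx
    obtain ⟨w, h1, h2, h3, h4⟩ := (mem_bulkPath_iff hG hW hsH hsv).1 hx
    have hwP : w ∈ P s := mem_of_onPath_of_mem_reachSet hG hW ((hPA s hs).trans hAW)
      (hPs.mem_reachSet hsP hvP) h1 h2
    by_cases hxw : x = w
    · exact hxw ▸ hwP
    have hxA : x ∈ A := by
      by_cases hwv : w = v
      · subst hwv
        exact .inl ((mem_bulkPath_iff hG hW hvH hvv).2 ⟨w, hvv, hvv, h3, h4⟩)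
      · refine .inr (h3.trans ?_)
        rcases h1.total hW (hSA s hs) with hc | hc
        · exact hc
        · by_cases huw : u = w
          · exact huw ▸ hc
          · exact absurd (h2.antisymm hW (hc.of_adj huw huv.mem hadj)) hwv
    obtain ⟨t, ht, hxt⟩ : ∃ t ∈ S ∩ A, x ∈ P t := by
      rw [← hcov] at hxA
      simpa only [mem_iUnion, exists_prop] using hxA
    obtain ⟨hPt, htP, -⟩ := hP t ht
    obtain ⟨η, hηadj, hxη, hηw⟩ := h3.exists_child hG hW hxw
    have htη : ¬ OnPath G W t r η := fun hc =>
      hηadj.ne (h4 η ⟨t, ht.1, hc⟩ hxη hηw)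
    obtain ⟨-, p, hpP, hp1, hp2⟩ := exists_crossing hG ((hPA t ht).trans hAW)
      (hPt.mem_reachSet hxt htP) hxη htη
    obtain rfl := parent_unique hW hp1 hηadj hp2 hηw
    by_cases hst : s = t
    · exact hst ▸ hxt
    · exact absurd hpP (Set.disjoint_left.1 (hdisj hs ht hst) hwP)

/-- If one bulk path starting at `v` is cheap and all proper hub subtrees below `v` are
self-sufficient, then so is the subtree rooted at `v`. -/
theorem selfSufficient_rootedBelow [Finite V] (hG : G.IsAcyclic) (hW : IsSubtree G W)
    (hSW : S ⊆ W) (hleaf : ∀ s ∈ S, IsLeafOf G W s) (hrS : r ∉ S)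
    (hs : s ∈ S) (hsv : OnPath G W s r v)
    (hcost : f (bulkPath G W S r v s) s ≤ 𝒯)
    (hbelow : ∀ m ∈ hubVerts G W S r, OnPath G W m r v → m ≠ v →
      SelfSufficient G f 𝒯 S (rootedBelow G W r m)) :
    SelfSufficient G f 𝒯 S (rootedBelow G W r v) := by
  classical
  have hr := hsv.2.1
  have hsH := mem_hubVerts_of_mem (G := G) hr hSW hs
  set B := bulkPath G W S r v s
  have hmemB : ∀ x, x ∈ B ↔ _ := fun x => mem_bulkPath_iff hG hW hsH hsv
  -- the hub nodes hanging off the path from `s` to `v`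
  let M : Set V := {m | m ∈ hubVerts G W S r ∧ ¬ OnPath G W s r m ∧
    ∃ w, G.Adj m w ∧ OnPath G W m r w ∧ OnPath G W s r w ∧ OnPath G W w r v}
  have hMlt : ∀ m ∈ M, OnPath G W m r v := fun m ⟨_, _, w, _, h1, _, h2⟩ => h1.trans h2
  have hMss : ∀ m ∈ M, SelfSufficient G f 𝒯 S (rootedBelow G W r m) := fun m hm =>
    hbelow m hm.1 (hMlt m hm) fun h => hm.2.1 (h ▸ hsv)
  have hMle : ∀ m ∈ M, ∀ m' ∈ M, OnPath G W m r m' → m = m' := by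
    intro m hm m' hm' h
    by_contra hne
    obtain ⟨-, -, w, hadj, hmw, hsw, -⟩ := hm
    exact hm'.2.1 (hsw.trans (h.of_adj hne hmw.mem hadj))
  have hMuniq : ∀ x, ∀ m ∈ M, ∀ m' ∈ M, OnPath G W x r m → OnPath G W x r m' → m = m' := by
    intro x m hm m' hm' h h'
    rcases h.total hW h' with hc | hc
    · exact hMle m hm m' hm' hc
    · exact (hMle m' hm' m hm hc).symm
  have hMB : ∀ x ∈ B, ∀ m ∈ M, ¬ OnPath G W x r m := by
    intro x hx m hm hxm
    obtain ⟨w, h1, h2, h3, h4⟩ := (hmemB x).1 hx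
    rcases h3.total hW hxm with hc | hc
    · exact hm.2.1 (h1.trans hc)
    · exact hm.2.1 (h4 m hm.1 hxm hc ▸ h1)
  have hMex : ∀ x, OnPath G W x r v → x ∉ B → ∃ m ∈ M, OnPath G W x r m := by
    intro x hxv hxB
    by_contra hcon
    push Not at hcon
    have hsx : OnPath G W s r x ∨ ∃ w, OnPath G W s r w ∧ OnPath G W w r v ∧
        OnPath G W x r w ∧ ∃ c, G.Adj c w ∧ OnPath G W c r w ∧ OnPath G W x r c ∧
          ¬ OnPath G W s r c := by
      refine hxv.climb hG hW (P := fun z => OnPath G W s r z ∨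
        ∃ w, OnPath G W s r w ∧ OnPath G W w r v ∧
        OnPath G W z r w ∧ ∃ c, G.Adj c w ∧ OnPath G W c r w ∧ OnPath G W z r c ∧
          ¬ OnPath G W s r c) (.inl hsv) ?_
      rintro z p hxz hpv hzp hadj (h | ⟨w, h1, h2, h3, c, h4, h5, h6, h7⟩)
      · by_cases hsz : OnPath G W s r z
        · exact .inl hsz
        · exact .inr ⟨p, h, hpv, hzp, z, hadj, hzp, onPath_self hr hzp.1, hsz⟩
      · exact .inr ⟨w, h1, h2, hzp.trans h3, c, h4, h5, hzp.trans h6, h7⟩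
    rcases hsx with hsx | ⟨w, h1, h2, h3, c, h4, h5, h6, h7⟩
    · exact hxB ((hmemB x).2 ⟨x, hsx, hxv, onPath_self hr hxv.1,
        fun y _ h1 h2 => h2.antisymm hW h1⟩)
    · refine hxB ((hmemB x).2 ⟨w, h1, h2, h3, fun y hy hxy hyw => ?_⟩)
      by_contra hne
      refine hcon c ⟨?_, h7, w, h4, h5, h1, h2⟩ h6
      rcases h6.total hW hxy with hc | hc
      · by_cases hcy : c = y
        · exact hcy ▸ hy
        · exact absurd (hyw.antisymm hW (hc.of_adj hcy h5.mem h4)) hne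
      · exact mem_hubVerts_of_onPath hy hc
  have hBv : ∀ x ∈ B, OnPath G W x r v := by
    intro x hx
    obtain ⟨w, -, h2, h3, -⟩ := (hmemB x).1 hx
    exact h3.trans h2
  have hsB : s ∈ B := (hmemB s).2 ⟨s, onPath_self hr hsv.1, hsv,
    onPath_self hr hsv.1, fun y _ h1 h2 => h2.antisymm hW h1⟩
  have hBS : ∀ t ∈ S, t ∈ B → t = s := by
    intro t ht htB
    obtain ⟨w, h1, -, h3, h4⟩ := (hmemB t).1 htB
    obtain rfl := h4 t (mem_hubVerts_of_mem hr hSW ht) (onPath_self hr h3.1) h3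
    exact (eq_of_onPath_of_isLeafOf hG hW (hleaf t ht) (ne_of_mem_of_not_mem ht hrS) h1).symm
  have htop' : ∀ t, ∃ m, t ∈ S → OnPath G W t r v → t ≠ s → m ∈ M ∧ OnPath G W t r m := by
    intro t
    by_cases h : t ∈ S ∧ OnPath G W t r v ∧ t ≠ s
    · obtain ⟨m, hm⟩ := hMex t h.2.1 fun hc => h.2.2 (hBS t h.1 hc)
      exact ⟨m, fun _ _ _ => hm⟩
    · exact ⟨t, fun h1 h2 h3 => absurd ⟨h1, h2, h3⟩ h⟩
  choose top htop using htop'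
  choose! Q hcov hQ hdisj using hMss
  have hQsub : ∀ m ∈ M, ∀ t ∈ S ∩ rootedBelow G W r m, ∀ x ∈ Q m t, OnPath G W x r m := by
    intro m hm t ht x hx
    have : x ∈ ⋃ t ∈ S ∩ rootedBelow G W r m, Q m t := mem_biUnion ht hx
    rwa [hcov m hm] at this
  have hQtop : ∀ t ∈ S ∩ rootedBelow G W r v, t ≠ s → ∀ x ∈ Q (top t) t,
      OnPath G W x r (top t) := by
    intro t ht hts
    obtain ⟨h1, h2⟩ := htop t ht.1 ht.2 hts
    exact hQsub _ h1 t ⟨ht.1, h2⟩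
  have hBQ : ∀ t ∈ S ∩ rootedBelow G W r v, t ≠ s → Disjoint B (Q (top t) t) :=
    fun t ht hts => Set.disjoint_left.2 fun x hxB hx =>
      hMB x hxB _ (htop t ht.1 ht.2 hts).1 (hQtop t ht hts x hx)
  refine ⟨fun t => if t = s then B else Q (top t) t, ?_, ?_, ?_⟩
  · ext x
    simp only [mem_iUnion, exists_prop]
    constructor
    · rintro ⟨t, ht, hx⟩
      split_ifs at hx with hts
      · exact hBv x hx
      · exact (hQtop t ht hts x hx).trans (hMlt _ (htop t ht.1 ht.2 hts).1)
    · intro hx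
      by_cases hxB : x ∈ B
      · exact ⟨s, ⟨hs, hsv⟩, by rwa [if_pos rfl]⟩
      obtain ⟨m, hm, hxm⟩ := hMex x hx hxB
      have hx' : x ∈ rootedBelow G W r m := hxm
      rw [← hcov m hm] at hx'
      simp only [mem_iUnion, exists_prop] at hx'
      obtain ⟨t, ⟨htS, htm⟩, hxt⟩ := hx'
      have hts : t ≠ s := fun h => hm.2.1 (h ▸ htm)
      have htv : OnPath G W t r v := OnPath.trans htm (hMlt m hm)
      obtain ⟨h1, h2⟩ := htop t htS htv hts
      refine ⟨t, ⟨htS, htv⟩, ?_⟩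
      rwa [if_neg hts, hMuniq t _ h1 m hm h2 htm]
  · intro t ht
    simp only
    split_ifs with hts
    · subst hts
      exact ⟨isSubtree_bulkPath hG hW hsH hsv, hsB, hcost⟩
    · obtain ⟨h1, h2⟩ := htop t ht.1 ht.2 hts
      exact hQ _ h1 t ⟨ht.1, h2⟩
  · intro t ht t' ht' hne
    simp only
    split_ifs with hts hts' hts'
    · exact absurd (hts.trans hts'.symm) hne
    · exact hBQ t' ht' hts'
    · exact (hBQ t ht hts).symm
    · obtain ⟨h1, h2⟩ := htop t ht.1 ht.2 hts
      obtain ⟨h1', h2'⟩ := htop t' ht'.1 ht'.2 hts'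
      by_cases htt : top t = top t'
      · rw [← htt] at h2' ⊢
        exact hdisj _ h1 ⟨ht.1, h2⟩ ⟨ht'.1, h2'⟩ hne
      · exact Set.disjoint_left.2 fun x hx hx' =>
          htt (hMuniq x _ h1 _ h1' (hQtop t ht hts x hx) (hQtop t' ht' hts' x hx'))

end SelfSufficiency

/-- Corollary `SStesting`: if `T(v)` is RC-viable and every hub-tree child
subtree `T₋ᵥ(uᵢ)` is recursively self-sufficient, then exactly one of the following holds:
(i) some child `u` has `f(BP(v,s),s) > 𝒯` for every sink `s ∈ S ∩ V₋ᵥ(u)`, and then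
`(u,v)` satisfies the reaching criterion; or (ii) every child `u` has a sink
`s ∈ S ∩ V₋ᵥ(u)` with `f(BP(v,s),s) ≤ 𝒯`, and then `T(v)` is recursively self-sufficient. -/
theorem statement_9 [Fintype V] (G : SimpleGraph V) (hG : G.IsTree)
    (f : Set V → V → ℝ≥0∞) (hf : IsMinmaxMonotone G f) (𝒯 : ℝ≥0∞)
    (W S : Set V) (hW : IsSubtree G W) (hSW : S ⊆ W)
    (hSleaf : ∀ s ∈ S, IsLeafOf G W s)
    (r : V) (hS2 : 2 ≤ S.ncard) (hW2 : 2 < W.ncard) (hroot : GoodRoot G W S r)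
    (v : V) (hv : v ∈ hubVerts G W S r)
    (hRCv : RCViableBelow G f 𝒯 W S r v)
    (hall : ∀ u : V, HubParent G W S r u v →
      RecursivelySelfSufficientOn G f 𝒯 W S r (rootedBelow G W r u)) :
    Xor'
      (∃ u : V, HubParent G W S r u v ∧
        (∀ s ∈ S ∩ reachSet G (W \ {v}) u, 𝒯 < f (bulkPath G W S r v s) s) ∧
        ReachingPair G f 𝒯 W S r u v)
      ((∀ u : V, HubParent G W S r u v →
          ∃ s ∈ S ∩ reachSet G (W \ {v}) u, f (bulkPath G W S r v s) s ≤ 𝒯) ∧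
        RecursivelySelfSufficientOn G f 𝒯 W S r (rootedBelow G W r v)) := by
  have hac := hG.isAcyclic
  obtain ⟨hr, hrS, -⟩ := hroot
  have hself : ∀ u, HubParent G W S r u v → SelfSufficient G f 𝒯 S (rootedBelow G W r u) := by
    intro u hu
    have := hall u hu u ⟨hu.1, onPath_self hr hu.2.2.2.1⟩
    rwa [inter_self] at this
  by_cases hex : ∃ u : V, HubParent G W S r u v ∧
      ∀ s ∈ S ∩ reachSet G (W \ {v}) u, 𝒯 < f (bulkPath G W S r v s) s
  · obtain ⟨u, hu, hlt⟩ := hex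
    refine .inl ⟨⟨u, hu, hlt, hu, ?_, ?_⟩, fun hcon => ?_⟩
    · rw [reachSet_child hac hW hu.2.2.1 hu.2.2.2]
      exact hself u hu
    · exact not_selfSufficient_of_forall_lt hac hf hW hSW hSleaf hrS hu hlt
    · obtain ⟨s, hs, hle⟩ := hcon.1 u hu
      exact (hlt s hs).not_ge hle
  · refine .inr ⟨⟨?_, ?_⟩, fun ⟨u, hu, hlt, _⟩ => hex ⟨u, hu, hlt⟩⟩ <;> push Not at hex
    · exact hex
    have hproper : ∀ m ∈ hubVerts G W S r, OnPath G W m r v → m ≠ v →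
        SelfSufficient G f 𝒯 S (rootedBelow G W r m) := by
      intro m hm hmv hne
      obtain ⟨u, hadj, hmu, huv⟩ := hmv.exists_child hac hW hne
      have hu : HubParent G W S r u v := ⟨mem_hubVerts_of_onPath hm hmu, hv, hadj, huv⟩
      have h := hall u hu m ⟨hm, hmu⟩
      rwa [rootedBelow_inter_of_onPath hmu] at h
    rintro w ⟨hwH, hwv⟩
    rw [rootedBelow_inter_of_onPath hwv]
    by_cases hwne : w = v
    swap
    · exact hproper w hwH hwv hwne
    subst hwne
    obtain ⟨s, hs, hle⟩ : ∃ s ∈ S, ∃ _ : OnPath G W s r w, f (bulkPath G W S r w s) s ≤ 𝒯 := by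
      obtain ⟨t, ht, htw⟩ := hv
      by_cases htne : t = w
      · subst htne
        refine ⟨t, ht, htw, ?_⟩
        have hone : bulkPath G W S r t t = {t} := by
          ext x
          rw [mem_bulkPath_iff hac hW hwH htw, mem_singleton_iff]
          constructor
          · rintro ⟨y, h1, h2, h3, -⟩
            obtain rfl := h1.antisymm hW h2
            exact eq_of_onPath_of_isLeafOf hac hW (hSleaf _ ht) (ne_of_mem_of_not_mem ht hrS) h3
          · rintro rfl
            exact ⟨x, htw, htw, htw, fun y _ h1 h2 => h2.antisymm hW h1⟩
        rw [hone, hf.singleton_eq_zero]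
        exact zero_le
      · obtain ⟨u, hadj, htu, huw⟩ := htw.exists_child hac hW htne
        obtain ⟨s, ⟨hs, hsu⟩, hle⟩ := hex u ⟨⟨t, ht, htu⟩, hwH, hadj, huw⟩
        rw [reachSet_child hac hW hadj huw] at hsu
        exact ⟨s, hs, OnPath.trans hsu huw, hle⟩
    obtain ⟨hsw, hle⟩ := hle
    exact selfSufficient_rootedBelow hac hW hSW hSleaf hrS hs hsw hle hproper
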